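/- arXiv:2110.00089 — 2 statements merged into one kernel-verified Lean document; each statement's English description precedes it below -/
import Mathlib

section
/- Let m, s ≥ 0 be integers with m + 2s ≥ 2, let G = (ℤ/2ℤ)^{⋆m} ⋆ ℤ^{⋆s} be the free product of m copies of the cyclic group of order 2 (with generators x₁,…,x_m) and s copies of the infinite cyclic group (with generators y₁,…,y_s), and let S = {x₁, …, x_m, y₁, y₁^{−1}, …, y_s, y_s^{−1}}. Then limsup_{n→∞} CL(n;G,S)^{1/n} = 2·(m + 2s − 1)^{1/2} (equivalently, the radius of convergence of the cogrowth series is 1/(2·(m+2s−1)^{1/2})). -/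
/-- `CL S n` is the number of words of length `n` over the alphabet `S` whose
product equals the identity of the group. -/
noncomputable def CL {G : Type*} [Group G] (S : Set G) (n : ℕ) : ℕ :=
  Nat.card {w : Fin n → G // (∀ i, w i ∈ S) ∧ (List.ofFn w).prod = 1}

section ReducedWords

variable {A : Type*} [DecidableEq A] (inv : A → A)

/-- Words over `A` in which no letter `a` is directly followed by `inv a`. -/
abbrev ReducedWord : Type _ := {l : List A // l.IsChain fun a b => b ≠ inv a}

/-- Left multiplication of a word by a letter, with cancellation. -/
def pushLetter (a : A) : List A → List A
  | [] => [a]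
  | b :: t => if b = inv a then t else a :: b :: t

variable {inv}

theorem isChain_pushLetter (a : A) {l : List A}
    (hl : l.IsChain fun a b => b ≠ inv a) :
    (pushLetter inv a l).IsChain fun a b => b ≠ inv a := by
  cases l with
  | nil => simp [pushLetter]
  | cons b t =>
    simp only [pushLetter]
    split_ifs with h
    · exact hl.tail
    · exact List.IsChain.cons_cons h hl

theorem pushLetter_inv_pushLetter (hinv : Function.Involutive inv) (a : A) {l : List A}
    (hl : l.IsChain fun a b => b ≠ inv a) :
    pushLetter inv (inv a) (pushLetter inv a l) = l := by
  cases l with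
  | nil => simp [pushLetter, hinv a]
  | cons b t =>
    by_cases h : b = inv a
    · subst h
      cases t with
      | nil => simp [pushLetter]
      | cons c t =>
        have : c ≠ inv (inv a) := by
          rw [List.isChain_cons_cons] at hl
          exact hl.1
        simp [pushLetter, this]
    · simp [pushLetter, h, hinv a]

namespace ReducedWord

/-- The empty reduced word. -/
def nil : ReducedWord inv := ⟨[], by simp⟩

/-- Left multiplication of a reduced word by a letter. -/
def push (a : A) (r : ReducedWord inv) : ReducedWord inv :=
  ⟨pushLetter inv a r.1, isChain_pushLetter a r.2⟩

theorem push_inv_push (hinv : Function.Involutive inv) (a : A) (r : ReducedWord inv) :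
    push (inv a) (push a r) = r :=
  Subtype.ext (pushLetter_inv_pushLetter hinv a r.2)

theorem push_push_inv (hinv : Function.Involutive inv) (a : A) (r : ReducedWord inv) :
    push a (push (inv a) r) = r := by
  simpa only [hinv a] using push_inv_push hinv (inv a) r

/-- Left multiplication by a letter as a permutation of the reduced words. -/
def pushPerm (hinv : Function.Involutive inv) (a : A) : Equiv.Perm (ReducedWord inv) where
  toFun := push a
  invFun := push (inv a)
  left_inv := push_inv_push hinv a
  right_inv := push_push_inv hinv a

theorem pushPerm_inv (hinv : Function.Involutive inv) (a : A) :
    pushPerm hinv (inv a) = (pushPerm hinv a)⁻¹ := by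
  ext r : 1
  rfl

theorem sum_length_push [Fintype A] (hinv : Function.Involutive inv) (q : ℕ)
    (hq : Fintype.card A = q + 1) (F : ℕ → ℕ) (r : ReducedWord inv) :
    ∑ a, F (push a r).1.length =
      match r.1.length with
      | 0 => (q + 1) * F 1
      | k + 1 => F k + q * F (k + 2) := by
  obtain ⟨l, hl⟩ := r
  cases l with
  | nil => simp [push, pushLetter, hq]
  | cons b t =>
    have hF : ∀ a ∈ Finset.univ.erase (inv b),
        F (push a (⟨b :: t, hl⟩ : ReducedWord inv)).1.length = F (t.length + 2) := by
      intro a ha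
      have : b ≠ inv a := by
        rintro rfl
        simp [hinv a] at ha
      simp [push, pushLetter, this]
    rw [← Finset.add_sum_erase _ _ (Finset.mem_univ (inv b)), Finset.sum_congr rfl hF]
    simp [push, pushLetter, hinv b, hq]

end ReducedWord

end ReducedWords

/-- The number of walks of length `n` in the `(q + 1)`-regular tree from a vertex at distance `k`
from the root to the root. -/
def treeWalks (q : ℕ) : ℕ → ℕ → ℕ
  | 0, 0 => 1
  | 0, _ + 1 => 0
  | n + 1, 0 => (q + 1) * treeWalks q n 1
  | n + 1, k + 1 => treeWalks q n k + q * treeWalks q n (k + 2)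

namespace ReducedWord

variable {A : Type*} [DecidableEq A] [Fintype A] {inv : A → A}

theorem card_foldr_push (hinv : Function.Involutive inv) (q : ℕ)
    (hq : Fintype.card A = q + 1) (n : ℕ) (r : ReducedWord inv) :
    Nat.card {w : Fin n → A // (List.ofFn w).foldr push (nil : ReducedWord inv) = r} =
      treeWalks q n r.1.length := by
  induction n generalizing r with
  | zero =>
    obtain ⟨l, hl⟩ := r
    cases l with
    | nil =>
      simp [nil, treeWalks]
    | cons b t =>
      simp [nil, treeWalks]
  | succ n ih =>
    have e : {w : Fin (n + 1) → A // (List.ofFn w).foldr push (nil : ReducedWord inv) = r} ≃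
        Σ a : A, {w : Fin n → A //
          (List.ofFn w).foldr push (nil : ReducedWord inv) = push (inv a) r} :=
      { toFun := fun w => ⟨w.1 0, Fin.tail w.1, by
          have h := w.2
          rw [List.ofFn_succ, List.foldr_cons] at h
          exact (push_inv_push hinv _ _).symm.trans (congrArg _ h)⟩
        invFun := fun p => ⟨Fin.cons p.1 p.2.1, by
          rw [List.ofFn_succ, List.foldr_cons]
          simp only [Fin.cons_zero, Fin.cons_succ]
          rw [p.2.2, push_push_inv hinv]⟩
        left_inv := fun w => Subtype.ext (Fin.cons_self_tail w.1)
        right_inv := fun p => by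
          obtain ⟨a, w, hw⟩ := p
          rfl }
    rw [Nat.card_congr e, Nat.card_sigma]
    simp only [ih]
    rw [hinv.bijective.sum_comp (fun a => treeWalks q n (push a r).1.length),
      sum_length_push hinv q hq]
    cases r.1.length <;> rfl

/-- If the letters act on a group compatibly with the action on reduced words, then words with
trivial product are the closed walks in a regular tree. -/
theorem CL_range_eq_treeWalks {G : Type*} [Group G] (hinv : Function.Involutive inv) (q : ℕ)
    (hq : Fintype.card A = q + 1) (σ : A → G) (hσ : ∀ a, σ (inv a) = (σ a)⁻¹)
    (φ : G →* Equiv.Perm (ReducedWord inv)) (hφ : ∀ a, φ (σ a) = pushPerm hinv a) (n : ℕ) :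
    CL (Set.range σ) n = treeWalks q n 0 := by
  have act : ∀ (l : List A) (r : ReducedWord inv), φ (l.map σ).prod r = l.foldr push r := by
    intro l r
    induction l with
    | nil => simp
    | cons a l ih =>
      rw [List.map_cons, List.prod_cons, map_mul, Equiv.Perm.mul_apply, ih, hφ]
      rfl
  have prod_push : ∀ (a : A) (r : ReducedWord inv),
      ((push a r).1.map σ).prod = σ a * (r.1.map σ).prod := by
    rintro a ⟨l, hl⟩
    cases l with
    | nil => simp [push, pushLetter]
    | cons b t =>
      by_cases h : b = inv a
      · simp [push, pushLetter, h, hσ]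
      · simp [push, pushLetter, h]
  have prod_foldr : ∀ l : List A,
      ((l.foldr push (nil : ReducedWord inv)).1.map σ).prod = (l.map σ).prod := by
    intro l
    induction l with
    | nil => rfl
    | cons a l ih => rw [List.foldr_cons, prod_push, ih, List.map_cons, List.prod_cons]
  have prod_eq_one : ∀ l : List A,
      (l.map σ).prod = 1 ↔ l.foldr push (nil : ReducedWord inv) = nil := by
    intro l
    constructor
    · intro h
      rw [← act, h, map_one]
      rfl
    · intro h
      rw [← prod_foldr, h]
      simp [nil]
  have σ_inj : Function.Injective σ := by
    intro a b hab
    have h : push a (nil : ReducedWord inv) = push b nil := by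
      have := congrArg (fun g => φ g nil) hab
      simp only [hφ] at this
      exact this
    simpa [push, nil, pushLetter] using congrArg Subtype.val h
  have hcount := card_foldr_push hinv q hq n (nil : ReducedWord inv)
  rw [show (nil : ReducedWord inv).1.length = 0 from rfl] at hcount
  rw [← hcount, CL]
  symm
  refine Nat.card_congr (Equiv.ofBijective
    (fun w => ⟨fun i => σ (w.1 i), fun i => ⟨_, rfl⟩, ?_⟩) ⟨?_, ?_⟩)
  · have := (prod_eq_one _).2 w.2
    rwa [List.map_ofFn] at this
  · intro w v h
    refine Subtype.ext (funext fun i => σ_inj ?_)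
    exact congrFun (congrArg Subtype.val h) i
  · rintro ⟨w, hw, hp⟩
    obtain ⟨v, hv⟩ : ∃ v : Fin n → A, ∀ i, σ (v i) = w i :=
      ⟨fun i => (hw i).choose, fun i => (hw i).choose_spec⟩
    refine ⟨⟨v, ?_⟩, Subtype.ext (funext hv)⟩
    rw [← prod_eq_one, List.map_ofFn, ← hp]
    congr 2
    exact funext hv

end ReducedWord

section TreeWalks

theorem treeWalks_le {q : ℕ} (hq : 1 ≤ q) (n k : ℕ) :
    (treeWalks q n k : ℝ) * √q ^ k ≤ (2 * √q) ^ n := by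
  have hs : √(q : ℝ) * √q = q := Real.mul_self_sqrt (Nat.cast_nonneg q)
  have hq' : (1 : ℝ) ≤ q := by exact_mod_cast hq
  have hpos : 0 ≤ √(q : ℝ) := Real.sqrt_nonneg _
  induction n generalizing k with
  | zero => cases k <;> simp [treeWalks]
  | succ n ih =>
    cases k with
    | zero =>
      have h := ih 1
      simp only [treeWalks]
      push_cast
      calc ((q : ℝ) + 1) * treeWalks q n 1 * √q ^ 0
          ≤ (2 * (√q * √q)) * treeWalks q n 1 := by
            rw [pow_zero, mul_one, hs]
            gcongr
            linarith
        _ = 2 * √q * (treeWalks q n 1 * √q ^ 1) := by ring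
        _ ≤ 2 * √q * (2 * √q) ^ n := by gcongr
        _ = (2 * √q) ^ (n + 1) := by ring
    | succ k =>
      simp only [treeWalks]
      push_cast
      calc ((treeWalks q n k : ℝ) + q * treeWalks q n (k + 2)) * √q ^ (k + 1)
          = √q * (treeWalks q n k * √q ^ k) + √q * (treeWalks q n (k + 2) * √q ^ (k + 2)) := by
            linear_combination -(treeWalks q n (k + 2) : ℝ) * √q ^ (k + 1) * hs
        _ ≤ √q * (2 * √q) ^ n + √q * (2 * √q) ^ n := by
            gcongr
            · exact ih k
            · exact ih (k + 2)
        _ = (2 * √q) ^ (n + 1) := by ring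

/-- The number of nonnegative paths with steps `±1` from `k` to `0` with `j` steps up. -/
def ballot : ℕ → ℕ → ℕ
  | 0, _ => 1
  | j + 1, 0 => ballot j 1
  | j + 1, k + 1 => ballot (j + 1) k + ballot j (k + 2)

theorem pow_mul_ballot_le_treeWalks (q j k : ℕ) :
    q ^ j * ballot j k ≤ treeWalks q (k + 2 * j) k := by
  induction j generalizing k with
  | zero =>
    induction k with
    | zero => simp [ballot, treeWalks]
    | succ k ih =>
      rw [show k + 1 + 2 * 0 = (k + 2 * 0) + 1 by ring]
      simp only [ballot, treeWalks] at ih ⊢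
      exact ih.trans (Nat.le_add_right _ _)
  | succ j ih =>
    induction k with
    | zero =>
      have h := ih 1
      rw [show 0 + 2 * (j + 1) = (1 + 2 * j) + 1 by ring]
      simp only [ballot, treeWalks]
      calc q ^ (j + 1) * ballot j 1 = q * (q ^ j * ballot j 1) := by ring
        _ ≤ (q + 1) * treeWalks q (1 + 2 * j) 1 := by gcongr; simp
    | succ k ihk =>
      have h := ih (k + 2)
      rw [show k + 1 + 2 * (j + 1) = (k + 2 + 2 * j) + 1 by ring]
      rw [show k + 2 * (j + 1) = k + 2 + 2 * j by ring] at ihk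
      simp only [ballot, treeWalks]
      calc q ^ (j + 1) * (ballot (j + 1) k + ballot j (k + 2))
          = q ^ (j + 1) * ballot (j + 1) k + q * (q ^ j * ballot j (k + 2)) := by ring
        _ ≤ _ := by gcongr

theorem ballot_succ_add_choose (j k : ℕ) :
    ballot (j + 1) k + (k + 2 * j + 2).choose j = (k + 2 * j + 2).choose (j + 1) := by
  induction j generalizing k with
  | zero =>
    induction k with
    | zero => simp [ballot]
    | succ k ih =>
      simp [ballot] at ih ⊢
      omega
  | succ j ih =>
    induction k with
    | zero =>
      have h := ih 1
      have hsymm : (2 * j + 3).choose (j + 2) = (2 * j + 3).choose (j + 1) :=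
        Nat.choose_symm_of_eq_add (by ring)
      rw [show 1 + 2 * j + 2 = 2 * j + 3 by ring] at h
      rw [show 0 + 2 * (j + 1) + 2 = (2 * j + 3) + 1 by ring, Nat.choose_succ_succ',
        Nat.choose_succ_succ' _ (j + 1), ballot, hsymm]
      omega
    | succ k ihk =>
      have h := ih (k + 2)
      rw [show k + 2 + 2 * j + 2 = k + 2 * j + 4 by ring] at h
      rw [show k + 2 * (j + 1) + 2 = k + 2 * j + 4 by ring] at ihk
      rw [show k + 1 + 2 * (j + 1) + 2 = (k + 2 * j + 4) + 1 by ring, Nat.choose_succ_succ',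
        Nat.choose_succ_succ' _ (j + 1), ballot]
      omega

theorem centralBinom_eq_mul_ballot {n : ℕ} (hn : 0 < n) :
    n.centralBinom = (n + 1) * ballot n 0 := by
  obtain ⟨j, rfl⟩ : ∃ j, n = j + 1 := ⟨n - 1, by omega⟩
  have h := ballot_succ_add_choose j 0
  have h2 := Nat.choose_succ_right_eq (2 * j + 2) j
  rw [show 2 * j + 2 - j = j + 2 by omega] at h2
  rw [show 0 + 2 * j + 2 = 2 * j + 2 by ring] at h
  rw [Nat.centralBinom_eq_two_mul_choose, show 2 * (j + 1) = 2 * j + 2 by ring]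
  nlinarith

theorem le_treeWalks_mul_sq (q : ℕ) {n : ℕ} (hn : 0 < n) :
    (4 * q) ^ n ≤ treeWalks q (2 * n) 0 * (2 * n) ^ 2 := by
  have h1 := Nat.four_pow_le_two_mul_self_mul_centralBinom n hn
  have h2 := pow_mul_ballot_le_treeWalks q n 0
  rw [zero_add] at h2
  rw [centralBinom_eq_mul_ballot hn] at h1
  calc (4 * q) ^ n = q ^ n * 4 ^ n := by rw [mul_pow, mul_comm]
    _ ≤ q ^ n * (2 * n * ((n + 1) * ballot n 0)) := by gcongr
    _ = (q ^ n * ballot n 0) * ((2 * n) * (n + 1)) := by ring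
    _ ≤ treeWalks q (2 * n) 0 * ((2 * n) * (2 * n)) := by
        gcongr
        omega
    _ = _ := by ring

theorem limsup_treeWalks {q : ℕ} (hq : 1 ≤ q) :
    Filter.limsup (fun n : ℕ => (treeWalks q n 0 : ℝ) ^ (1 / (n : ℝ))) Filter.atTop =
      2 * √q := by
  have hpos : 0 ≤ 2 * √(q : ℝ) := by positivity
  have upper : ∀ᶠ n : ℕ in Filter.atTop, (treeWalks q n 0 : ℝ) ^ (1 / (n : ℝ)) ≤ 2 * √q := by
    filter_upwards [Filter.eventually_ge_atTop 1] with n hn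
    have h := treeWalks_le hq n 0
    rw [pow_zero, mul_one] at h
    calc (treeWalks q n 0 : ℝ) ^ (1 / (n : ℝ)) ≤ ((2 * √q) ^ n) ^ (1 / (n : ℝ)) := by gcongr
      _ = 2 * √q := by rw [one_div, Real.pow_rpow_inv_natCast hpos (by omega)]
  have lower : ∀ n : ℕ, 0 < n → 2 * √q / (((2 * n : ℕ) : ℝ) ^ (1 / ((2 * n : ℕ) : ℝ))) ^ 2 ≤
      (treeWalks q (2 * n) 0 : ℝ) ^ (1 / ((2 * n : ℕ) : ℝ)) := by
    intro n hn
    have hN : (0 : ℝ) < ((2 * n : ℕ) : ℝ) := by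
      have : 0 < 2 * n := by omega
      exact_mod_cast this
    have h : ((4 * q) ^ n : ℝ) ≤ treeWalks q (2 * n) 0 * ((2 * n : ℕ) : ℝ) ^ 2 := by
      exact_mod_cast le_treeWalks_mul_sq q hn
    have hs : (2 * √(q : ℝ)) ^ (2 * n) = (4 * q) ^ n := by
      rw [pow_mul, mul_pow, Real.sq_sqrt (Nat.cast_nonneg q)]
      norm_num
    rw [div_le_iff₀ (by positivity)]
    calc 2 * √(q : ℝ) = ((2 * √q) ^ (2 * n)) ^ (1 / ((2 * n : ℕ) : ℝ)) := by
          rw [one_div, Real.pow_rpow_inv_natCast hpos (by omega)]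
      _ ≤ (treeWalks q (2 * n) 0 * ((2 * n : ℕ) : ℝ) ^ 2) ^ (1 / ((2 * n : ℕ) : ℝ)) := by
          rw [hs]
          gcongr
      _ = _ := by
          rw [Real.mul_rpow (by positivity) (by positivity), Real.rpow_pow_comm hN.le]
  have htop : Filter.Tendsto (fun n : ℕ => 2 * n) Filter.atTop Filter.atTop :=
    Filter.tendsto_id.const_mul_atTop' two_pos
  have lim : Filter.Tendsto
      (fun n : ℕ => 2 * √(q : ℝ) / (((2 * n : ℕ) : ℝ) ^ (1 / ((2 * n : ℕ) : ℝ))) ^ 2)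
      Filter.atTop (nhds (2 * √q)) := by
    have h := (tendsto_rpow_div.comp (tendsto_natCast_atTop_atTop.comp htop)).pow 2
    have h2 := (tendsto_const_nhds (x := 2 * √(q : ℝ))).div h (by norm_num)
    rw [one_pow, div_one] at h2
    exact h2
  apply le_antisymm
  · refine Filter.limsup_le_of_le ?_ upper
    exact Filter.isCoboundedUnder_le_of_le Filter.atTop (x := 0) fun n => by positivity
  · refine le_of_forall_lt fun c hc => ?_
    obtain ⟨d, hcd, hd⟩ := exists_between hc
    refine hcd.trans_le (Filter.le_limsup_of_frequently_le ?_ ⟨_, Filter.eventually_map.2 upper⟩)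
    refine htop.frequently (Filter.Eventually.frequently ?_)
    filter_upwards [lim.eventually_const_lt hd, Filter.eventually_gt_atTop 0] with n h1 h2
    exact h1.le.trans (lower n h2)

end TreeWalks

theorem exists_monoidHom_ofAdd_one {P : Type*} [Group P] (p : P) (hp : p * p = 1) :
    ∃ f : Multiplicative (ZMod 2) →* P, f (Multiplicative.ofAdd 1) = p := by
  let g : ZMod 2 →+ Additive P := ZMod.lift 2 ⟨zmultiplesHom _ (Additive.ofMul p), by
    simp [← ofMul_zpow, zpow_ofNat, pow_two, hp]⟩
  refine ⟨AddMonoidHom.toMultiplicativeLeft g, ?_⟩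
  have : g 1 = Additive.ofMul p := by
    have := ZMod.lift_coe 2 ⟨zmultiplesHom (Additive P) (Additive.ofMul p), by
      simp [← ofMul_zpow, zpow_ofNat, pow_two, hp]⟩ 1
    simpa using this
  simp [this]

/-- The formal inverse on the letters `x i`, `y j`, `(y j)⁻¹`. -/
def letterInv (m s : ℕ) : Fin m ⊕ Fin s × Bool → Fin m ⊕ Fin s × Bool :=
  Sum.map id (Prod.map id not)

theorem letterInv_involutive (m s : ℕ) : Function.Involutive (letterInv m s) := by
  rintro (i | ⟨j, b⟩) <;> simp [letterInv]

theorem limsup_CL_of_hom_reducedWord {G : Type*} [Group G] {m s : ℕ} (hms : 2 ≤ m + 2 * s)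
    (x : Fin m → G) (y : Fin s → G) (hxx : ∀ i, x i * x i = 1)
    (φ : G →* Equiv.Perm (ReducedWord (letterInv m s)))
    (hφx : ∀ i, φ (x i) = ReducedWord.pushPerm (letterInv_involutive m s) (Sum.inl i))
    (hφy : ∀ j, φ (y j) = ReducedWord.pushPerm (letterInv_involutive m s) (Sum.inr (j, true))) :
    Filter.limsup (fun n : ℕ =>
        (CL (Set.range x ∪ Set.range y ∪ Set.range fun j => (y j)⁻¹) n : ℝ) ^ (1 / (n : ℝ)))
      Filter.atTop
      = 2 * ((m : ℝ) + 2 * s - 1) ^ ((1 : ℝ) / 2) := by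
  have hinv := letterInv_involutive m s
  let σ : Fin m ⊕ Fin s × Bool → G := Sum.elim x fun p => if p.2 then y p.1 else (y p.1)⁻¹
  have hσ : ∀ a, σ (letterInv m s a) = (σ a)⁻¹ := by
    rintro (i | ⟨j, b⟩)
    · exact eq_inv_of_mul_eq_one_left (hxx i)
    · cases b <;> simp [σ, letterInv]
  have hrange : Set.range x ∪ Set.range y ∪ (Set.range fun j => (y j)⁻¹) = Set.range σ := by
    ext g
    simp [σ, or_assoc, exists_or, or_comm]
  have hφ : ∀ a, φ (σ a) = ReducedWord.pushPerm hinv a := by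
    rintro (i | ⟨j, b⟩)
    · exact hφx i
    · cases b
      · simp only [σ, Sum.elim_inr, Bool.false_eq_true, if_false, map_inv, hφy]
        exact (ReducedWord.pushPerm_inv hinv (Sum.inr (j, true))).symm
      · simp [σ, hφy]
  obtain ⟨q, hq⟩ : ∃ q, m + 2 * s = q + 1 := ⟨m + 2 * s - 1, by omega⟩
  have hcard : Fintype.card (Fin m ⊕ Fin s × Bool) = q + 1 := by
    simp
    omega
  have hreal : (m : ℝ) + 2 * s - 1 = q := by
    have : (m : ℝ) + 2 * s = q + 1 := by exact_mod_cast hq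
    linarith
  simp only [hrange, ReducedWord.CL_range_eq_treeWalks hinv q hcard σ hσ φ hφ]
  rw [limsup_treeWalks (by omega), hreal, Real.sqrt_eq_rpow]

/-- For `m, s ≥ 0` with `m + 2s ≥ 2`, the exponential growth rate
`limsup CL(n;G,S)^{1/n}` of the cogrowth of `(ℤ/2ℤ)^{⋆m} ⋆ ℤ^{⋆s}` with respect to
`S = {x₁,…,x_m, y₁^{±1},…,y_s^{±1}}` equals `2 (m + 2s − 1)^{1/2}`. -/
theorem cogrowth_limsup_free_product_involutions_and_free (m s : ℕ) (hms : 2 ≤ m + 2 * s)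
    (x : Fin m → Monoid.Coprod (Monoid.CoprodI (fun _ : Fin m => Multiplicative (ZMod 2)))
      (Monoid.CoprodI (fun _ : Fin s => Multiplicative ℤ)))
    (y : Fin s → Monoid.Coprod (Monoid.CoprodI (fun _ : Fin m => Multiplicative (ZMod 2)))
      (Monoid.CoprodI (fun _ : Fin s => Multiplicative ℤ)))
    (hx : ∀ i, x i = Monoid.Coprod.inl (Monoid.CoprodI.of (i := i)
      (Multiplicative.ofAdd (1 : ZMod 2))))
    (hy : ∀ j, y j = Monoid.Coprod.inr (Monoid.CoprodI.of (i := j)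
      (Multiplicative.ofAdd (1 : ℤ)))) :
    Filter.limsup (fun n : ℕ =>
        (CL (Set.range x ∪ Set.range y ∪ Set.range fun j => (y j)⁻¹) n : ℝ) ^ (1 / (n : ℝ)))
      Filter.atTop
      = 2 * ((m : ℝ) + 2 * s - 1) ^ ((1 : ℝ) / 2) := by
  have hinv := letterInv_involutive m s
  have hsq : ∀ i, ReducedWord.pushPerm hinv (Sum.inl i) *
      ReducedWord.pushPerm hinv (Sum.inl i) = 1 := fun i =>
    mul_eq_one_iff_eq_inv.2 (ReducedWord.pushPerm_inv hinv (Sum.inl i))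
  choose f hf using fun i => exists_monoidHom_ofAdd_one _ (hsq i)
  refine limsup_CL_of_hom_reducedWord hms x y (fun i => ?_)
    (Monoid.Coprod.lift (Monoid.CoprodI.lift f) (Monoid.CoprodI.lift fun j =>
      zpowersHom _ (ReducedWord.pushPerm hinv (Sum.inr (j, true)))))
    (fun i => ?_) (fun j => ?_)
  · have h : (Monoid.CoprodI.of (M := fun _ : Fin m => Multiplicative (ZMod 2)) (i := i)
        (Multiplicative.ofAdd (1 : ZMod 2))) *
        (Monoid.CoprodI.of (M := fun _ : Fin m => Multiplicative (ZMod 2)) (i := i)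
          (Multiplicative.ofAdd (1 : ZMod 2))) = 1 := by
      rw [← map_mul, ← ofAdd_add, show (1 : ZMod 2) + 1 = 0 from rfl, ofAdd_zero, map_one]
    rw [hx]
    refine (map_mul Monoid.Coprod.inl _ _).symm.trans ?_
    exact (congrArg _ h).trans (map_one _)
  · rw [hx]
    refine (Monoid.Coprod.lift_apply_inl _ _ _).trans ?_
    exact (Monoid.CoprodI.lift_of _ _).trans (hf i)
  · rw [hy]
    refine (Monoid.Coprod.lift_apply_inr _ _ _).trans ?_
    refine (Monoid.CoprodI.lift_of _ _).trans ?_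
    simp
end

section
/- Let G be a group generated by a finite nonempty symmetric subset S ⊆ G (symmetric means S = S^{−1}). Then L := limsup_{n→∞} CL(n;G,S)^{1/n} satisfies L ∈ {1, 2} ∪ [2√2, ∞); that is, either L = 1, or L = 2, or L ≥ 2√2. -/
open Filter

/-- The number of words of length `n` over `S` whose product equals `g`. -/
noncomputable def wordCount {G : Type*} [Group G] (S : Set G) (n : ℕ) (g : G) : ℕ :=
  Nat.card {w : Fin n → G // (∀ i, w i ∈ S) ∧ (List.ofFn w).prod = g}

/-- Splitting off the first letter of a word. -/
def wordConsEquiv {G : Type*} [Group G] (S : Set G) (n : ℕ) (g : G) :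
    {w : Fin (n + 1) → G // (∀ i, w i ∈ S) ∧ (List.ofFn w).prod = g} ≃
      Σ s : S, {w : Fin n → G // (∀ i, w i ∈ S) ∧ (List.ofFn w).prod = (s : G)⁻¹ * g} where
  toFun w := ⟨⟨w.1 0, w.2.1 0⟩, Fin.tail w.1, fun i => w.2.1 i.succ, by
    have h := w.2.2
    rw [List.ofFn_succ, List.prod_cons] at h
    exact eq_inv_mul_of_mul_eq h⟩
  invFun p := ⟨Fin.cons p.1.1 p.2.1, by
    refine ⟨fun i => ?_, ?_⟩
    · refine Fin.cases ?_ (fun i => ?_) i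
      · simp
      · exact p.2.2.1 i
    · simp [List.ofFn_succ, p.2.2.2]⟩
  left_inv w := Subtype.ext (Fin.cons_self_tail w.1)
  right_inv p := rfl

lemma finite_words {G : Type*} {S : Set G} (hfin : S.Finite) (n : ℕ) (p : (Fin n → G) → Prop) :
    Finite {w : Fin n → G // (∀ i, w i ∈ S) ∧ p w} := by
  have : Finite S := hfin
  refine Finite.of_injective (β := Fin n → S) (fun w i => ⟨w.1 i, w.2.1 i⟩) fun v w h => ?_
  ext i
  exact congrArg Subtype.val (congrFun h i)

lemma wordCount_succ {G : Type*} [Group G] (S : Set G) [Fintype S] (n : ℕ) (g : G) :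
    wordCount S (n + 1) g = ∑ s : S, wordCount S n ((s : G)⁻¹ * g) := by
  have (s : S) : Finite {w : Fin n → G //
      (∀ i, w i ∈ S) ∧ (List.ofFn w).prod = (s : G)⁻¹ * g} := finite_words S.toFinite n _
  rw [wordCount, Nat.card_congr (wordConsEquiv S n g), Nat.card_sigma]
  rfl

lemma wordCount_zero_one {G : Type*} [Group G] (S : Set G) : wordCount S 0 1 = 1 := by
  simp [wordCount]

/-- The ballot number counting nonnegative lattice paths with `j + k` up steps
and `j` down steps. -/
noncomputable def ballotNumber (j k : ℕ) : ℝ :=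
  (2 * j + k).factorial * (k + 1) / (j.factorial * (j + k + 1).factorial)

lemma ballotNumber_nonneg (j k : ℕ) : 0 ≤ ballotNumber j k := by
  unfold ballotNumber; positivity

lemma ballotNumber_zero_left (k : ℕ) : ballotNumber 0 k = 1 := by
  have := Nat.factorial_ne_zero k
  simp only [ballotNumber, mul_zero, zero_add, Nat.factorial_succ, Nat.factorial_zero]
  push_cast
  field_simp

lemma ballotNumber_succ_zero (j : ℕ) : ballotNumber (j + 1) 0 = ballotNumber j 1 := by
  have := Nat.factorial_ne_zero j
  simp only [ballotNumber, show 2 * (j + 1) + 0 = 2 * j + 1 + 1 by ring, add_zero,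
    Nat.factorial_succ]
  push_cast
  field_simp
  ring

lemma ballotNumber_succ_succ (j k : ℕ) :
    ballotNumber (j + 1) (k + 1) = ballotNumber (j + 1) k + ballotNumber j (k + 2) := by
  have := Nat.factorial_ne_zero j
  have := Nat.factorial_ne_zero (j + k)
  simp only [ballotNumber, show 2 * (j + 1) + (k + 1) = 2 * j + k + 1 + 1 + 1 by ring,
    show 2 * (j + 1) + k = 2 * j + k + 1 + 1 by ring,
    show 2 * j + (k + 2) = 2 * j + k + 1 + 1 by ring,
    show j + 1 + (k + 1) + 1 = j + k + 1 + 1 + 1 by ring,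
    show j + 1 + k + 1 = j + k + 1 + 1 by ring,
    show j + (k + 2) + 1 = j + k + 1 + 1 + 1 by ring, Nat.factorial_succ]
  push_cast
  field_simp
  ring

lemma four_pow_le_ballotNumber {j : ℕ} (hj : 0 < j) :
    (4 : ℝ) ^ j ≤ 2 * j * (j + 1) * ballotNumber j 0 := by
  have h : (4 : ℝ) ^ j ≤ 2 * j * j.centralBinom := by
    exact_mod_cast Nat.four_pow_le_two_mul_self_mul_centralBinom j hj
  have h' : (j + 1) * ballotNumber j 0 = (j.centralBinom : ℝ) := by
    have := Nat.factorial_ne_zero j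
    rw [Nat.centralBinom, Nat.cast_choose ℝ (by lia : j ≤ 2 * j), show 2 * j - j = j by lia]
    simp only [ballotNumber, add_zero, Nat.factorial_succ]
    push_cast
    field_simp
    simp
  rw [mul_assoc, h']
  exact h

/-- Every element represented by a word of length `k` over `S` is represented by at least as many
words of length `2 * j + k` as in the regular tree of degree `q + 1`. -/
lemma pow_mul_ballotNumber_le_wordCount {G : Type*} [Group G] (S : Set G) [Fintype S]
    (hsymm : S = S⁻¹) (q : ℕ) (hq : Fintype.card S = q + 1) (n : ℕ) :
    ∀ (j : ℕ) (l : List G), n = 2 * j + l.length → (∀ x ∈ l, x ∈ S) →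
      (q : ℝ) ^ j * ballotNumber j l.length ≤ wordCount S n l.prod := by
  classical
  have hinv (s : S) : (s : G)⁻¹ ∈ S := Set.mem_inv.mp (hsymm ▸ s.2)
  induction n with
  | zero =>
    intro j l hn _
    obtain rfl : j = 0 := by lia
    obtain rfl : l = [] := List.length_eq_zero_iff.mp (by lia)
    simp [wordCount_zero_one, ballotNumber_zero_left]
  | succ n ih =>
    intro j l hn hl
    rw [wordCount_succ]
    push_cast
    rcases l with _ | ⟨a, l⟩
    · obtain ⟨j, rfl⟩ : ∃ i, j = i + 1 := ⟨j - 1, by simp at hn; lia⟩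
      have hterm (s : S) : (q : ℝ) ^ j * ballotNumber j 1 ≤
          wordCount S n ((s : G)⁻¹ * [].prod) := by
        have := ih j [(s : G)⁻¹] (by simp at hn ⊢; lia) (by simpa using hinv s)
        simpa using this
      have hsum := Finset.card_nsmul_le_sum Finset.univ _ _ fun s _ => hterm s
      rw [Finset.card_univ, hq, nsmul_eq_mul] at hsum
      refine le_trans ?_ hsum
      have := mul_nonneg (pow_nonneg (Nat.cast_nonneg (α := ℝ) q) j) (ballotNumber_nonneg j 1)
      rw [List.length_nil, ballotNumber_succ_zero, pow_succ]
      push_cast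
      linarith
    · have ha : a ∈ S := hl a (by simp)
      have hl' : ∀ x ∈ l, x ∈ S := fun x hx => hl x (by simp [hx])
      rw [List.length_cons] at hn ⊢
      rw [← Finset.add_sum_erase _ _ (Finset.mem_univ (⟨a, ha⟩ : S)), List.prod_cons,
        inv_mul_cancel_left]
      have hhead := ih j l (by lia) hl'
      rcases j with _ | j
      · rw [ballotNumber_zero_left] at hhead ⊢
        exact hhead.trans (le_add_of_nonneg_right (Finset.sum_nonneg fun _ _ => Nat.cast_nonneg _))
      · have hterm (s : S) : (q : ℝ) ^ j * ballotNumber j (l.length + 2) ≤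
            wordCount S n ((s : G)⁻¹ * (a * l.prod)) := by
          have := ih j ((s : G)⁻¹ :: a :: l) (by simp; lia) (by simpa [hinv s, ha] using hl')
          simpa using this
        have hsum := Finset.card_nsmul_le_sum (Finset.univ.erase (⟨a, ha⟩ : S)) _ _
          fun s _ => hterm s
        rw [Finset.card_erase_of_mem (Finset.mem_univ _), Finset.card_univ, hq,
          Nat.add_sub_cancel, nsmul_eq_mul] at hsum
        rw [ballotNumber_succ_succ, mul_add]
        refine add_le_add hhead (le_trans (le_of_eq ?_) hsum)
        ring

lemma CL_le_pow {G : Type*} [Group G] {S : Set G} (hfin : S.Finite) (n : ℕ) :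
    CL S n ≤ S.ncard ^ n := by
  have : Finite S := hfin
  have h := Nat.card_le_card_of_injective
    (fun (w : {w : Fin n → G // (∀ i, w i ∈ S) ∧ (List.ofFn w).prod = 1}) (i : Fin n) =>
      (⟨w.1 i, w.2.1 i⟩ : S)) fun v w h => by
        ext i
        exact congrArg Subtype.val (congrFun h i)
  rw [Nat.card_fun, Nat.card_fin] at h
  exact h

lemma CL_rpow_le {G : Type*} [Group G] {S : Set G} (hfin : S.Finite) {n : ℕ} (hn : n ≠ 0) :
    (CL S n : ℝ) ^ (1 / (n : ℝ)) ≤ S.ncard := by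
  have h : (CL S n : ℝ) ≤ (S.ncard : ℝ) ^ n := by exact_mod_cast CL_le_pow hfin n
  calc (CL S n : ℝ) ^ (1 / (n : ℝ)) ≤ ((S.ncard : ℝ) ^ n) ^ (1 / (n : ℝ)) := by gcongr
    _ = S.ncard := by rw [one_div, Real.pow_rpow_inv_natCast (by positivity) hn]

lemma isBoundedUnder_CL_rpow {G : Type*} [Group G] {S : Set G} (hfin : S.Finite) :
    IsBoundedUnder (· ≤ ·) atTop fun n : ℕ => (CL S n : ℝ) ^ (1 / (n : ℝ)) :=
  isBoundedUnder_of_eventually_le (a := (S.ncard : ℝ)) <|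
    (eventually_ne_atTop 0).mono fun _ hn => CL_rpow_le hfin hn

lemma limsup_CL_rpow_le {G : Type*} [Group G] {S : Set G} (hfin : S.Finite) :
    limsup (fun n : ℕ => (CL S n : ℝ) ^ (1 / (n : ℝ))) atTop ≤ S.ncard :=
  limsup_le_of_le (isCoboundedUnder_le_of_le atTop (x := 0) fun _ => by positivity)
    ((eventually_ne_atTop 0).mono fun _ hn => CL_rpow_le hfin hn)

lemma two_mul_sqrt_le_limsup_CL_rpow {G : Type*} [Group G] {S : Set G} (hfin : S.Finite)
    (hsymm : S = S⁻¹) (q : ℕ) (hq : S.ncard = q + 1) :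
    2 * √(q : ℝ) ≤ limsup (fun n : ℕ => (CL S n : ℝ) ^ (1 / (n : ℝ))) atTop := by
  have := hfin.fintype
  by_contra! hlt
  set L := limsup (fun n : ℕ => (CL S n : ℝ) ^ (1 / (n : ℝ))) atTop
  have hL : 0 ≤ L := le_limsup_of_frequently_le (Frequently.of_forall fun _ => by positivity)
    (isBoundedUnder_CL_rpow hfin)
  obtain ⟨c, hLc, hc⟩ := exists_between hlt
  have hc0 : 0 < c := hL.trans_lt hLc
  have hev := eventually_lt_of_limsup_lt hLc (isBoundedUnder_CL_rpow hfin)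
  have hr : 1 < 4 * q / c ^ 2 := by
    rw [one_lt_div (by positivity)]
    calc c ^ 2 < (2 * √(q : ℝ)) ^ 2 := by gcongr
      _ = 4 * (q : ℝ) := by rw [mul_pow, Real.sq_sqrt (by positivity)]; norm_num
  have hlim := tendsto_pow_const_div_const_pow_of_one_lt 2 hr
  have hsmall : ∀ᶠ j : ℕ in atTop, (j : ℝ) ^ 2 / (4 * q / c ^ 2) ^ j < 1 / 4 :=
    hlim.eventually_lt_const (by norm_num)
  have hev' := (tendsto_id.const_mul_atTop' (show 0 < 2 by norm_num)).eventually hev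
  obtain ⟨j, hj, hj0, hj'⟩ := (hsmall.and ((eventually_gt_atTop 0).and hev')).exists
  simp only [id] at hj'
  have hCL : (CL S (2 * j) : ℝ) < c ^ (2 * j) := by
    rw [one_div, Real.rpow_inv_lt_iff_of_pos (by positivity) hc0.le (by positivity)] at hj'
    exact_mod_cast hj'
  have hlow : (q : ℝ) ^ j * ballotNumber j 0 ≤ CL S (2 * j) :=
    pow_mul_ballotNumber_le_wordCount S hsymm q
      (by rw [← hq, ← Nat.card_coe_set_eq, Nat.card_eq_fintype_card]) (2 * j) j [] rfl (by simp)
  have hj1 : (1 : ℝ) ≤ j := by exact_mod_cast hj0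
  have hup : (4 * q : ℝ) ^ j ≤ 4 * j ^ 2 * c ^ (2 * j) := calc
    (4 * q : ℝ) ^ j = q ^ j * 4 ^ j := by rw [mul_pow, mul_comm]
    _ ≤ q ^ j * (2 * j * (j + 1) * ballotNumber j 0) := by
      gcongr
      exact four_pow_le_ballotNumber hj0
    _ = 2 * j * (j + 1) * (q ^ j * ballotNumber j 0) := by ring
    _ ≤ 2 * j * (j + j) * c ^ (2 * j) := by
      have := ballotNumber_nonneg j 0
      gcongr
      exact hlow.trans hCL.le
    _ = 4 * j ^ 2 * c ^ (2 * j) := by ring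
  rw [div_lt_iff₀ (by positivity), div_pow, ← pow_mul, ← mul_div_assoc,
    lt_div_iff₀ (by positivity)] at hj
  linarith

lemma one_le_limsup_CL_rpow {G : Type*} [Group G] {S : Set G} (hfin : S.Finite)
    (hne : S.Nonempty) (hsymm : S = S⁻¹) :
    1 ≤ limsup (fun n : ℕ => (CL S n : ℝ) ^ (1 / (n : ℝ))) atTop := by
  have := hfin.fintype
  obtain ⟨s, hs⟩ := hne
  have hs' : s⁻¹ ∈ S := by rwa [hsymm, Set.inv_mem_inv]
  have hpos (m : ℕ) : 1 ≤ CL S (2 * m) := by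
    have := finite_words hfin (2 * m) fun w => (List.ofFn w).prod = 1
    have : Nonempty {w : Fin (2 * m) → G // (∀ i, w i ∈ S) ∧ (List.ofFn w).prod = 1} := by
      refine ⟨fun i => if (i : ℕ) % 2 = 0 then s else s⁻¹, fun i => ?_, ?_⟩
      · dsimp only
        split_ifs <;> assumption
      · rw [List.ofFn_mul']
        simp [List.prod_flatten, Nat.add_mod]
    exact Nat.card_pos
  refine le_limsup_of_frequently_le (frequently_atTop.mpr fun n => ⟨2 * n, by lia, ?_⟩)
    (isBoundedUnder_CL_rpow hfin)
  exact Real.one_le_rpow (by exact_mod_cast hpos n) (by positivity)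

/-- **gap theorem.** If `G` is a group generated by a finite nonempty
symmetric subset `S`, then `L := limsup CL(n;G,S)^{1/n}` satisfies
`L ∈ {1, 2} ∪ [2√2, ∞)`. -/
theorem cogrowth_rate_gap {G : Type*} [Group G] (S : Set G)
    (hfin : S.Finite) (hne : S.Nonempty) (hsymm : S = S⁻¹)
    (hgen : Subgroup.closure S = ⊤)
    (L : ℝ) (hL : L = Filter.limsup (fun n : ℕ => (CL S n : ℝ) ^ (1 / (n : ℝ))) Filter.atTop) :
    L = 1 ∨ L = 2 ∨ 2 * Real.sqrt 2 ≤ L := by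
  obtain ⟨q, hq⟩ := Nat.exists_eq_succ_of_ne_zero ((Set.ncard_pos hfin).mpr hne).ne'
  have hle := limsup_CL_rpow_le hfin
  have hge := two_mul_sqrt_le_limsup_CL_rpow hfin hsymm q hq
  rw [← hL, hq] at hle
  rw [← hL] at hge
  rcases q with _ | _ | q
  · refine Or.inl (le_antisymm (by simpa using hle) ?_)
    rw [hL]
    exact one_le_limsup_CL_rpow hfin hne hsymm
  · refine Or.inr (Or.inl (le_antisymm ?_ ?_))
    · norm_num at hle
      exact hle
    · simpa using hge
  · refine Or.inr (Or.inr (le_trans ?_ hge))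
    gcongr
    push_cast
    linarith [Nat.cast_nonneg (α := ℝ) q]
end
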